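/- Let μ be the Bernoulli measure on {a,b}^ℕ with μ(a) = p and μ(b) = 1−p, 0 < p < 1, and let f be the run-length encoder. Then the Rényi entropy of order 2 of the pushforward measure exists and H₂(f_*μ) = −lim_{n→∞} (1/n) log Σ_{C_n} (f_*μ)(C_n)² = −(1/2)·log( p(1−p) / ((1+p)(2−p)) ). -/

import Mathlib

open MeasureTheory Filter Topology

section RLEDefs

variable {A : Type*}

/-- The starting position of the run following the run that starts at position `i`:
the least index `> i` where the value of `x` changes (with the junk convention `i + 1`
if the sequence is constant from position `i` on). -/
noncomputable def nextChange (x : ℕ → A) (i : ℕ) : ℕ := by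
  classical
  exact if h : ∃ j, x (i + j + 1) ≠ x i then i + Nat.find h + 1 else i + 1

/-- Starting position of the `n`-th maximal run of the sequence `x`. -/
noncomputable def runStart (x : ℕ → A) : ℕ → ℕ
  | 0 => 0
  | n + 1 => nextChange x (runStart x n)

/-- The run-length encoder `f : A^ℕ → (A × ℕ)^ℕ`: the `n`-th symbol of `f x` is the pair
(value of the `n`-th maximal run of `x`, length of that run). -/
noncomputable def rle (x : ℕ → A) (n : ℕ) : A × ℕ :=
  (x (runStart x n), runStart x (n + 1) - runStart x n)

/-- `M_n(u,v)`: the length of the longest common substring of `u` and `v`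
occurring within their first `n` symbols, i.e.
`max {k : u_i^{i+k-1} = v_j^{j+k-1} for some 0 ≤ i,j ≤ n-k}`. -/
noncomputable def matchLen {C : Type*} (u v : ℕ → C) (n : ℕ) : ℕ :=
  sSup {k | ∃ i j, i + k ≤ n ∧ j + k ≤ n ∧ ∀ m < k, u (i + m) = v (j + m)}

/-- `M^RLE_n(x,y) = M_n(f x, f y)`. -/
noncomputable def MRLE (x y : ℕ → A) (n : ℕ) : ℕ := matchLen (rle x) (rle y) n

/-- `M̃_n(x,y) = max {k : f(σ^i x)_1^k = f(σ^j y)_1^k for some 0 ≤ i,j ≤ n-k}`. -/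
noncomputable def Mtilde (x y : ℕ → A) (n : ℕ) : ℕ :=
  sSup {k | ∃ i j, i + k ≤ n ∧ j + k ≤ n ∧
    ∀ m < k, rle (fun t => x (t + i)) m = rle (fun t => y (t + j)) m}

/-- The number of maximal runs in the first `n` symbols of `x`, i.e. `|f(x_1^n)|`. -/
noncomputable def runCount (x : ℕ → A) (n : ℕ) : ℕ := by
  classical
  exact ((Finset.range n).filter fun i => i = 0 ∨ x i ≠ x (i - 1)).card

/-- The left shift `σ` on sequences. -/
def shift (x : ℕ → A) : ℕ → A := fun n => x (n + 1)

variable [MeasurableSpace A]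

/-- `Σ_{ω ∈ B^n} (f_*μ)(ω)²`: the sum, over all cylinders `ω` of length `n` in
`B^ℕ = (A × ℕ)^ℕ`, of the squared measure of `f⁻¹ω` (where `f` is the run-length
encoder), i.e. of the squared pushforward measure of the cylinder. -/
noncomputable def pushCylSum (μ : Measure (ℕ → A)) (n : ℕ) : ℝ :=
  ∑' ω : Fin n → A × ℕ, ((μ {x | ∀ i : Fin n, rle x i = ω i}).toReal) ^ 2

/-- Lower Rényi entropy of order 2 of the pushforward measure `f_*μ`:
`H̲₂(f_*μ) = - liminf_n (1/n) log Σ_ω (f_*μ)(ω)²`. -/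
noncomputable def H2lower (μ : Measure (ℕ → A)) : ℝ :=
  -liminf (fun n : ℕ => Real.log (pushCylSum μ n) / n) atTop

/-- Upper Rényi entropy of order 2 of the pushforward measure `f_*μ`:
`H̄₂(f_*μ) = - limsup_n (1/n) log Σ_ω (f_*μ)(ω)²`. -/
noncomputable def H2upper (μ : Measure (ℕ → A)) : ℝ :=
  -limsup (fun n : ℕ => Real.log (pushCylSum μ n) / n) atTop

/-- Hypothesis (A): there are `c > 0`, `h > 0` with `μ(a…a) ≤ c e^{-hn}` for every
constant cylinder `a…a` of length `n`. -/
def HypA (μ : Measure (ℕ → A)) (c h : ℝ) : Prop :=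
  0 < c ∧ 0 < h ∧
    ∀ (n : ℕ) (a : A), μ {x | ∀ i < n, x i = a} ≤ ENNReal.ofReal (c * Real.exp (-h * n))

/-- The σ-algebra `F_0^n` generated by the coordinates `X_0, …, X_n`. -/
def cylAlgLE (A : Type*) [MeasurableSpace A] (n : ℕ) : MeasurableSpace (ℕ → A) :=
  MeasurableSpace.comap (fun x (i : Fin (n + 1)) => x i) inferInstance

/-- The σ-algebra `F_m^∞` generated by the coordinates `X_m, X_{m+1}, …`. -/
def cylAlgGE (A : Type*) [MeasurableSpace A] (m : ℕ) : MeasurableSpace (ℕ → A) :=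
  MeasurableSpace.comap (fun x (i : ℕ) => x (m + i)) inferInstance

/-- α-mixing with rate function `a`: for all `n, g` and all `S ∈ F_0^n`, `T ∈ F_{n+g}^∞`,
`|μ(S ∩ T) - μ(S)μ(T)| ≤ a(g)`. -/
def AlphaMixingBound (μ : Measure (ℕ → A)) (a : ℕ → ℝ) : Prop :=
  ∀ (n g : ℕ) (S T : Set (ℕ → A)),
    MeasurableSet[cylAlgLE A n] S → MeasurableSet[cylAlgGE A (n + g)] T →
    |(μ (S ∩ T)).toReal - (μ S).toReal * (μ T).toReal| ≤ a g

/-- α-mixing with exponential decay. -/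
def AlphaMixingExp (μ : Measure (ℕ → A)) : Prop :=
  ∃ C θ : ℝ, 0 < C ∧ 0 < θ ∧ AlphaMixingBound μ fun g => C * Real.exp (-θ * g)

/-- ψ-mixing with polynomial rate `ψ(g) = g^{-a}`: for all `n` and `g ≥ 1` and all
`S ∈ F_0^n`, `T ∈ F_{n+g}^∞`, `|μ(S ∩ T) - μ(S)μ(T)| ≤ g^{-a} μ(S) μ(T)`. -/
def PsiMixingPoly (μ : Measure (ℕ → A)) (a : ℝ) : Prop :=
  ∀ (n g : ℕ), 1 ≤ g → ∀ (S T : Set (ℕ → A)),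
    MeasurableSet[cylAlgLE A n] S → MeasurableSet[cylAlgGE A (n + g)] T →
    |(μ (S ∩ T)).toReal - (μ S).toReal * (μ T).toReal| ≤
      (g : ℝ) ^ (-a) * (μ S).toReal * (μ T).toReal

/-- `S_n = Σ_{0 ≤ i,j ≤ n-1} 1_{A_{i,j}}` with `A_{i,j} = {f(σ^i X)_1^k = f(σ^j Y)_1^k}`,
seen as a random variable on the product space (X = first coordinate, Y = second). -/
noncomputable def Sn (k n : ℕ) (p : (ℕ → A) × (ℕ → A)) : ℝ := by
  classical
  exact ∑ i ∈ Finset.range n, ∑ j ∈ Finset.range n,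
    if ∀ m < k, rle (fun t => p.1 (t + i)) m = rle (fun t => p.2 (t + j)) m then (1 : ℝ) else 0

end RLEDefs

section RLEProof

theorem nc_shift {A : Type*} (x : ℕ → A) (d i : ℕ) :
    nextChange x (d + i) = d + nextChange (fun t => x (d + t)) i := by
  classical
  have e : ∀ j, d + i + j + 1 = d + (i + j + 1) := fun j => by omega
  unfold nextChange
  simp only [e]
  split_ifs <;> omega

theorem rs_shift {A : Type*} (x : ℕ → A) (d : ℕ) (h : runStart x 1 = d) (n : ℕ) :
    runStart x (n + 1) = d + runStart (fun t => x (d + t)) n := by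
  induction n with
  | zero => simpa [runStart] using h
  | succ n ih =>
    rw [runStart, ih, nc_shift]; rfl

theorem rle_shift {A : Type*} (x : ℕ → A) (d : ℕ) (h : runStart x 1 = d) (n : ℕ) :
    rle x (n + 1) = rle (fun t => x (d + t)) n := by
  unfold rle
  rw [rs_shift x d h, rs_shift x d h (n+1)]
  simp only [Prod.mk.injEq, true_and]
  omega

def GoodSeq (x : ℕ → Bool) : Prop := ∀ i, ∃ j, x (i + j + 1) ≠ x i

theorem GoodSeq.shift {x : ℕ → Bool} (h : GoodSeq x) (d : ℕ) : GoodSeq (fun t => x (d + t)) := by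
  intro i
  obtain ⟨j, hj⟩ := h (d + i)
  exact ⟨j, by simpa [add_assoc] using hj⟩

theorem nc_eq_iff_gen {A : Type*} {x : ℕ → A} (h : ∃ j, x (0 + j + 1) ≠ x 0) (k : ℕ) :
    nextChange x 0 = k + 1 ↔ (∀ j < k, x (j + 1) = x 0) ∧ x (k + 1) ≠ x 0 := by
  classical
  unfold nextChange
  rw [dif_pos h, Nat.add_right_cancel_iff, zero_add, Nat.find_eq_iff]
  simp only [zero_add, not_not]
  tauto

theorem nc_eq_iff {x : ℕ → Bool} (hx : GoodSeq x) (k : ℕ) :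
    nextChange x 0 = k + 1 ↔ (∀ j < k, x (j + 1) = x 0) ∧ x (k + 1) ≠ x 0 :=
  nc_eq_iff_gen (hx 0) k

theorem nc_pos (x : ℕ → Bool) : ∃ k, nextChange x 0 = k + 1 := by
  classical
  unfold nextChange
  split_ifs with h
  · exact ⟨_, rfl⟩
  · exact ⟨0, rfl⟩

def encW {n : ℕ} (c : Bool) (k : Fin n → ℕ) : Fin n → Bool × ℕ :=
  fun i => (not^[(i : ℕ)] c, k i + 1)

def wordL : (n : ℕ) → Bool → (Fin n → ℕ) → List Bool
  | 0, c, _ => [c]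
  | n + 1, c, k => List.replicate (k 0 + 1) c ++ wordL n (!c) (fun i => k i.succ)

theorem good_enc {x : ℕ → Bool} (hx : GoodSeq x) (n : ℕ) :
    ∃ k : Fin n → ℕ, ∀ i : Fin n, rle x i = encW (x 0) k i := by
  induction n generalizing x with
  | zero => exact ⟨fun _ => 0, fun i => i.elim0⟩
  | succ n ih =>
    obtain ⟨k0, hk0⟩ := nc_pos x
    obtain ⟨k, hk⟩ := ih (hx.shift (k0 + 1))
    have h1 := (nc_eq_iff hx k0).1 hk0
    refine ⟨Fin.cons k0 k, fun i => ?_⟩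
    refine Fin.cases ?_ (fun i => ?_) i
    · simp [rle, encW, runStart, hk0]
    · have := hk i
      simp only [Fin.val_succ]
      rw [rle_shift x (k0 + 1) hk0, this]
      have h2 : x (k0 + 1) = !(x 0) := by
        have := h1.2
        revert this
        cases x (k0 + 1) <;> cases x 0 <;> simp
      simp [encW, h2]

theorem prefix_iff {x : ℕ → Bool} (hx : GoodSeq x) (n : ℕ) (c : Bool) (k : Fin n → ℕ) :
    (x 0 = c ∧ ∀ i : Fin n, rle x i = encW c k i) ↔
      ∀ i (h : i < (wordL n c k).length), x i = (wordL n c k)[i] := by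
  induction n generalizing x c with
  | zero =>
    simp [wordL]
  | succ n ih =>
    have ih' := ih (hx.shift (k 0 + 1)) (!c) (fun i => k i.succ)
    have key : (∀ i (h : i < (wordL (n+1) c k).length), x i = (wordL (n+1) c k)[i]) ↔
        (∀ i < k 0 + 1, x i = c) ∧ ∀ i (h : i < (wordL n (!c) (fun i => k i.succ)).length),
          x (k 0 + 1 + i) = (wordL n (!c) (fun i => k i.succ))[i] := by
      simp only [wordL]
      constructor
      · intro H
        refine ⟨fun i hi => ?_, fun i hi => ?_⟩
        · rw [H i (by simp; omega), List.getElem_append_left (by simpa using hi)]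
          simp
        · rw [H (k 0 + 1 + i) (by simp; omega), List.getElem_append_right (by simp)]
          simp
      · rintro ⟨H1, H2⟩ i hi
        by_cases h : i < k 0 + 1
        · rw [H1 i h, List.getElem_append_left (by simpa using h)]
          simp
        · obtain ⟨m, rfl⟩ := Nat.exists_eq_add_of_le (not_lt.1 h)
          rw [List.getElem_append_right (by simp), H2 m (by simp at hi; omega)]
          simp
    rw [key, ← ih', Fin.forall_fin_succ]
    have e0 : rle x ((0 : Fin (n+1)) : ℕ) = encW c k 0 ↔ x 0 = c ∧ nextChange x 0 = k 0 + 1 := by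
      simp [rle, encW, runStart]
    rw [e0, nc_eq_iff hx]
    have e1 : nextChange x 0 = k 0 + 1 → ∀ i : Fin n, rle x (i.succ : Fin (n+1)) =
        rle (fun t => x (k 0 + 1 + t)) i := fun h i => by
      simp only [Fin.val_succ]
      exact rle_shift x _ h i
    rw [nc_eq_iff hx] at e1
    have e2 : ∀ i : Fin n, encW c k i.succ = encW (!c) (fun i => k i.succ) i := fun i => by
      simp [encW]
    simp only [e2, add_zero]
    have e3 : (∀ i < k 0 + 1, x i = c) ↔ x 0 = c ∧ ∀ j < k 0, x (j+1) = c := by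
      constructor
      · exact fun H => ⟨H 0 (by omega), fun j hj => H _ (by omega)⟩
      · rintro ⟨H, H2⟩ i hi
        rcases i with _ | i
        · exact H
        · exact H2 i (by omega)
    rw [e3]
    constructor
    · rintro ⟨h0, ⟨-, h1⟩, h2⟩
      have e := e1 h1
      subst h0
      refine ⟨⟨rfl, h1.1⟩, ?_, fun i => by rw [← e i]; exact h2 i⟩
      have := h1.2
      revert this
      cases x (k 0 + 1) <;> cases x 0 <;> simp
    · rintro ⟨⟨h0, h1⟩, h2, h3⟩
      subst h0
      have h4 : (∀ j < k 0, x (j + 1) = x 0) ∧ x (k 0 + 1) ≠ x 0 := ⟨h1, by rw [h2]; simp⟩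
      exact ⟨rfl, ⟨rfl, h4⟩, fun i => by rw [e1 h4 i]; exact h3 i⟩

noncomputable def wt (p : ℝ) (c : Bool) : ℝ := if c then p else 1 - p

theorem wt_pos {p : ℝ} (hp0 : 0 < p) (hp1 : p < 1) (c : Bool) : 0 < wt p c := by
  unfold wt; split_ifs <;> linarith

theorem wt_lt {p : ℝ} (hp0 : 0 < p) (hp1 : p < 1) (c : Bool) : wt p c < 1 := by
  unfold wt; split_ifs <;> linarith

theorem meas_prefix (p : ℝ) (μ : Measure (ℕ → Bool))
    (hμ : ∀ (n : ℕ) (w : Fin n → Bool),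
      μ {x | ∀ i : Fin n, x i = w i} =
        ENNReal.ofReal (∏ i : Fin n, if w i then p else 1 - p)) (l : List Bool) :
    μ {x | ∀ i (h : i < l.length), x i = l[i]} = ENNReal.ofReal (l.map (wt p)).prod := by
  have h := hμ l.length (fun i => l[i])
  have e : (l.map (wt p)).prod = ∏ i : Fin l.length, wt p l[i] := by
    rw [← List.prod_ofFn]
    congr 1
    apply List.ext_getElem <;> simp
  rw [e]
  refine Eq.trans ?_ h
  congr 1
  ext x
  simp only [Set.mem_setOf_eq]
  exact ⟨fun H i => H i i.2, fun H i hi => H ⟨i, hi⟩⟩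

theorem meas_single {p : ℝ} (hp0 : 0 < p) (hp1 : p < 1) (μ : Measure (ℕ → Bool))
    (hμ : ∀ (n : ℕ) (w : Fin n → Bool),
      μ {x | ∀ i : Fin n, x i = w i} =
        ENNReal.ofReal (∏ i : Fin n, if w i then p else 1 - p)) (y : ℕ → Bool) :
    μ {y} = 0 := by
  have hb : ∀ n : ℕ, μ {y} ≤ ENNReal.ofReal ((max p (1 - p)) ^ n) := fun n => by
    refine (measure_mono (t := {x | ∀ i : Fin n, x i = y i}) ?_).trans ?_
    · rintro x rfl i; rfl
    · rw [hμ n (fun i => y i)]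
      apply ENNReal.ofReal_le_ofReal
      calc _ ≤ ∏ i : Fin n, max p (1 - p) := by
            apply Finset.prod_le_prod
            · intro i _; split_ifs <;> linarith
            · intro i _; split_ifs
              · exact le_max_left _ _
              · exact le_max_right _ _
        _ = _ := by simp
  have ht : Tendsto (fun n : ℕ => ENNReal.ofReal ((max p (1 - p)) ^ n)) atTop (𝓝 0) := by
    rw [← ENNReal.ofReal_zero]
    apply ENNReal.tendsto_ofReal
    apply tendsto_pow_atTop_nhds_zero_of_lt_one
    · exact hp0.le.trans (le_max_left _ _)
    · exact max_lt hp1 (by linarith)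
  exact le_antisymm (ge_of_tendsto' ht hb) zero_le

theorem good_ae {p : ℝ} (hp0 : 0 < p) (hp1 : p < 1) (μ : Measure (ℕ → Bool))
    (hμ : ∀ (n : ℕ) (w : Fin n → Bool),
      μ {x | ∀ i : Fin n, x i = w i} =
        ENNReal.ofReal (∏ i : Fin n, if w i then p else 1 - p)) :
    ∀ᵐ x ∂μ, GoodSeq x := by
  rw [ae_iff]
  refine measure_mono_null (t := ⋃ q : List Bool × Bool, {fun j => q.1.getD j q.2}) ?_
    (measure_iUnion_null fun q => meas_single hp0 hp1 μ hμ _)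
  intro x hx
  simp only [GoodSeq, Set.mem_setOf_eq, not_forall, not_exists, not_not] at hx
  obtain ⟨i, hi⟩ := hx
  refine Set.mem_iUnion.2 ⟨(List.ofFn (fun j : Fin i => x j), x i), ?_⟩
  rw [Set.mem_singleton_iff]
  ext1 j
  by_cases h : j < i
  · simp [List.getD_eq_getElem?_getD, h]
  · obtain ⟨m, rfl⟩ := Nat.exists_eq_add_of_le (not_lt.1 h)
    rcases m with _ | m
    · simp
    · have := hi m
      simp [List.getD_eq_getElem?_getD, ← this, add_assoc]

noncomputable def rr (p : ℝ) (c : Bool) : ℝ := wt p c ^ 2 * (1 - wt p c ^ 2)⁻¹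

noncomputable def TT (p : ℝ) : ℕ → Bool → ℝ
  | 0, c => wt p c ^ 2
  | n + 1, c => rr p c * TT p n (!c)

theorem hasSum_TT {p : ℝ} (hp0 : 0 < p) (hp1 : p < 1) (n : ℕ) (c : Bool) :
    HasSum (fun k : Fin n → ℕ => (((wordL n c k).map (wt p)).prod) ^ 2) (TT p n c) := by
  induction n generalizing c with
  | zero =>
    simpa [wordL, TT] using hasSum_unique (fun k : Fin 0 → ℕ => (((wordL 0 c k).map (wt p)).prod) ^ 2)
  | succ n ih =>
    have h1 : HasSum (fun k : ℕ => wt p c ^ 2 * (wt p c ^ 2) ^ k) (rr p c) := by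
      apply HasSum.mul_left
      apply hasSum_geometric_of_lt_one (sq_nonneg _)
      have := wt_pos hp0 hp1 c
      have := wt_lt hp0 hp1 c
      nlinarith
    have h2 := ih (!c)
    have hs := h1.summable.mul_of_nonneg h2.summable
      (fun k => by simp only [Pi.zero_apply]; positivity) (fun k => by simp only [Pi.zero_apply]; positivity)
    have h3 := h1.mul h2 hs
    rw [← (Fin.consEquiv (fun _ : Fin (n+1) => ℕ)).hasSum_iff]
    refine h3.congr_fun ?_ 
    intro q
    simp [wordL, Fin.consEquiv]
    ring

theorem push_eq {p : ℝ} (hp0 : 0 < p) (hp1 : p < 1) (μ : Measure (ℕ → Bool))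
    (hμ : ∀ (n : ℕ) (w : Fin n → Bool),
      μ {x | ∀ i : Fin n, x i = w i} =
        ENNReal.ofReal (∏ i : Fin n, if w i then p else 1 - p)) (n : ℕ) :
    pushCylSum μ (n + 1) = TT p (n + 1) true + TT p (n + 1) false := by
  have hg := good_ae hp0 hp1 μ hμ
  have hm : ∀ c (k : Fin (n+1) → ℕ), (μ {x | ∀ i : Fin (n+1), rle x i = encW c k i}).toReal =
      ((wordL (n+1) c k).map (wt p)).prod := fun c k => by
    have : μ {x | ∀ i : Fin (n+1), rle x i = encW c k i} =
        μ {x | ∀ i (h : i < (wordL (n+1) c k).length), x i = (wordL (n+1) c k)[i]} := by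
      apply measure_congr
      filter_upwards [hg] with x hx
      apply propext
      change (∀ i : Fin (n+1), rle x i = encW c k i) ↔
        (∀ i (h : i < (wordL (n+1) c k).length), x i = (wordL (n+1) c k)[i])
      rw [← prefix_iff hx]
      refine ⟨fun H => ⟨?_, H⟩, fun H => H.2⟩
      simpa [rle, runStart, encW] using congrArg Prod.fst (H 0)
    rw [this, meas_prefix p μ hμ, ENNReal.toReal_ofReal]
    apply List.prod_nonneg
    intro a ha
    obtain ⟨b, -, rfl⟩ := List.mem_map.1 ha
    exact (wt_pos hp0 hp1 b).le
  let e : (Fin (n+1) → ℕ) ⊕ (Fin (n+1) → ℕ) → (Fin (n+1) → Bool × ℕ) :=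
    Sum.elim (encW true) (encW false)
  have hinj : ∀ c, Function.Injective (encW c : (Fin (n+1) → ℕ) → _) := fun c k k' h => by
    ext i
    simpa [encW] using congrArg Prod.snd (congrFun h i)
  have he : Function.Injective e := by
    refine Function.Injective.sumElim (hinj _) (hinj _) ?_
    intro k k' h
    simpa [encW] using congrArg Prod.fst (congrFun h 0)
  unfold pushCylSum
  refine HasSum.tsum_eq ?_
  rw [← he.hasSum_iff]
  · apply HasSum.sum
    · simpa [Function.comp_def, e, hm] using hasSum_TT hp0 hp1 (n+1) true
    · simpa [Function.comp_def, e, hm] using hasSum_TT hp0 hp1 (n+1) false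
  · intro ω hω
    have : μ {x | ∀ i : Fin (n+1), rle x i = ω i} = 0 := by
      have : ∀ᵐ x ∂μ, ¬ (∀ i : Fin (n+1), rle x i = ω i) := by
        filter_upwards [hg] with x hx H
        apply hω
        obtain ⟨k, hk⟩ := good_enc hx (n+1)
        have : ω = encW (x 0) k := by
          ext1 i; rw [← H i, hk i]
        rw [this]
        cases x 0
        · exact ⟨Sum.inr k, rfl⟩
        · exact ⟨Sum.inl k, rfl⟩
      simpa [ae_iff] using this
    simp [this]

theorem limit_aux (S : ℕ → ℝ) (l : ℝ) (hl : 0 < l) (hS : ∀ n, 0 < S n)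
    (hr : ∀ n, S (n + 2) = l * S n) :
    Tendsto (fun n : ℕ => Real.log (S n) / n) atTop (𝓝 (1 / 2 * Real.log l)) := by
  set b : ℕ → ℝ := fun n => Real.log (S n) - n * (1 / 2 * Real.log l) with hb
  have hb2 : ∀ n, b (n + 2) = b n := fun n => by
    simp only [hb, hr, Real.log_mul hl.ne' (hS n).ne']
    push_cast; ring
  have hbd : ∀ n, |b n| ≤ |b 0| + |b 1| ∧ |b (n+1)| ≤ |b 0| + |b 1| := by
    intro n
    induction n with
    | zero => exact ⟨by linarith [abs_nonneg (b 1)], by simp⟩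
    | succ n ih => exact ⟨ih.2, by rw [hb2]; exact ih.1⟩
  have h0 : Tendsto (fun n : ℕ => b n / n) atTop (𝓝 0) := by
    have hc : Tendsto (fun n : ℕ => (|b 0| + |b 1|) / n) atTop (𝓝 0) :=
      tendsto_const_div_atTop_nhds_zero_nat _
    refine squeeze_zero_norm (fun n => ?_) hc
    rw [Real.norm_eq_abs, abs_div, Nat.abs_cast]
    exact div_le_div_of_nonneg_right (hbd n).1 (Nat.cast_nonneg n)
  have h1 := h0.add_const (1 / 2 * Real.log l)
  rw [zero_add] at h1
  refine h1.congr' ?_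
  filter_upwards [eventually_gt_atTop 0] with n hn
  have : (n : ℝ) ≠ 0 := by positivity
  simp only [hb]
  field_simp
  ring

theorem TT_pos {p : ℝ} (hp0 : 0 < p) (hp1 : p < 1) (n : ℕ) (c : Bool) : 0 < TT p n c := by
  induction n generalizing c with
  | zero => exact pow_pos (wt_pos hp0 hp1 c) 2
  | succ n ih =>
    have h1 := wt_pos hp0 hp1 c
    have h2 := wt_lt hp0 hp1 c
    have : 0 < 1 - wt p c ^ 2 := by nlinarith
    have := ih (!c)
    simp only [TT, rr]
    positivity

end RLEProof

/-- Example `exbern`: for the Bernoulli measure (`μ(a) = p`,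
`μ(b) = 1-p`, `0 < p < 1`), the Rényi entropy of order 2 of `f_*μ` exists and
`H₂(f_*μ) = -lim_n (1/n) log Σ_{C_n} (f_*μ)(C_n)² = -(1/2) log(p(1-p)/((1+p)(2-p)))`. -/
theorem stmt12 (p : ℝ) (hp0 : 0 < p) (hp1 : p < 1)
    (μ : Measure (ℕ → Bool)) [IsProbabilityMeasure μ]
    (hμ : ∀ (n : ℕ) (w : Fin n → Bool),
      μ {x | ∀ i : Fin n, x i = w i} =
        ENNReal.ofReal (∏ i : Fin n, if w i then p else 1 - p)) :
    Tendsto (fun n : ℕ => -(Real.log (pushCylSum μ n) / n)) atTop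
      (𝓝 (-(1 / 2) * Real.log (p * (1 - p) / ((1 + p) * (2 - p))))) := by
  have hl : rr p true * rr p false = p * (1 - p) / ((1 + p) * (2 - p)) := by
    have h1 : 1 - p ^ 2 = (1 - p) * (1 + p) := by ring
    have h2 : 1 - (1 - p) ^ 2 = p * (2 - p) := by ring
    have h3 : 1 - p ≠ 0 := by linarith
    have h4 : 1 + p ≠ 0 := by linarith
    have h5 : 2 - p ≠ 0 := by linarith
    simp only [rr, wt, if_true, Bool.false_eq_true, if_false, h1, h2]
    field_simp
  have hlp : 0 < p * (1 - p) / ((1 + p) * (2 - p)) := by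
    have h3 : 0 < 1 - p := by linarith
    have h5 : 0 < 2 - p := by linarith
    positivity
  have hL := limit_aux (fun n => TT p n true + TT p n false) _ hlp
    (fun n => add_pos (TT_pos hp0 hp1 n _) (TT_pos hp0 hp1 n _)) (fun n => by
      rw [← hl]; simp only [TT, Bool.not_true, Bool.not_false]; ring)
  have h := hL.neg
  rw [← neg_mul] at h
  refine h.congr' ?_
  filter_upwards [eventually_gt_atTop 0] with n hn
  obtain ⟨m, rfl⟩ := Nat.exists_eq_succ_of_ne_zero hn.ne'
  rw [push_eq hp0 hp1 μ hμ m]
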